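/- For every r-colored composition (α,ε) of n, the colored ribbon Schur function equals the colored quasisymmetric generating function of the conjugate-inverse colored descent class: r_{(α,ε)} = Σ_{(π,z) ∈ D̄_{(α,ε)}⁻¹} F^{(r)}_{co(π,z)}. -/

import Mathlib

/-- Auxiliary construction of the cells of a ribbon: each part of the list
contributes a row, rows are read from bottom to top (in English (row, column)
coordinates the row coordinate decreases as we go up), and each new row starts
in the column of the last cell of the previous row. -/
def ribbonAux : List ℕ → ℤ × ℤ → Finset (ℤ × ℤ)
  | [], _ => ∅
  | a :: rest, p =>
      ((Finset.range a).image fun j : ℕ => (p.1, p.2 + (j : ℤ))) ∪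
        ribbonAux rest (p.1 - 1, p.2 + (a : ℤ) - 1)

/-- The cells of the ribbon (zigzag diagram) whose row lengths, read from
bottom to top, are the entries of `l`. -/
def ribbonOfList (l : List ℕ) : Finset (ℤ × ℤ) := ribbonAux l (0, 0)
/-- The rainbow decomposition of a colored list: the unique way of grouping
adjacent entries of equal color into maximal monochromatic blocks.  Each block
is recorded as (list of first components, common color). -/
def rainbow {r : ℕ} : List (ℕ × Fin r) → List (List ℕ × Fin r)
  | [] => []
  | (a, c) :: rest =>
    match rainbow rest with
    | [] => [([a], c)]
    | (b, c') :: bs =>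
        if c = c' then (a :: b, c') :: bs else ([a], c) :: (b, c') :: bs
/-- The colored descent composition of a colored word (a list of
(letter, color) pairs): it records the lengths of the maximal increasing runs
of constant color, together with their colors. -/
def cco {r : ℕ} : List (ℕ × Fin r) → List (ℕ × Fin r)
  | [] => []
  | (a, c) :: rest =>
    match cco rest, rest with
    | (m, c0) :: t, (b, c') :: _ =>
        if c = c' ∧ a < b then (m + 1, c) :: t else (1, c) :: (m, c0) :: t
    | _, _ => [(1, c)]

/-- The window word of the colored permutation `(π, z)`:
the list `π₁^{z₁} π₂^{z₂} ⋯ π_n^{z_n}` of colored letters. -/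
def cword {n r : ℕ} (π : Equiv.Perm (Fin n)) (z : Fin n → Fin r) :
    List (ℕ × Fin r) :=
  (List.finRange n).map fun i => ((π i : ℕ), z i)
/-- The extended color vector of a colored composition: each color is repeated
as many times as the size of its part. -/
def colorWord {r : ℕ} (l : List (ℕ × Fin r)) : List (Fin r) :=
  (l.map fun p => List.replicate p.1 p.2).flatten

/-- Poirier's colored fundamental quasisymmetric function `F^{(r)}_{(α,ε)}`
associated with the colored composition `l` of `n`, in the `r` sets of
variables `x^{(j)}_i` indexed by `Fin r × ℕ`: the sum over all weakly
increasing `i₁ ≤ … ≤ i_n` which increase strictly at every partial sum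
`r_j = α₁ + … + α_j` with `ε_j ≥ ε_{j+1}`, of
`x^{(ε̃₁)}_{i_1} ⋯ x^{(ε̃_n)}_{i_n}` where `ε̃` is the extended color
vector. -/
noncomputable def Fcol {r : ℕ} [NeZero r] (n : ℕ) (l : List (ℕ × Fin r)) :
    MvPowerSeries (Fin r × ℕ) ℤ := fun d =>
  (({i : Fin n → ℕ |
      Monotone i ∧
      (∀ k, k + 1 < l.length → (l.getD (k + 1) (1, 0)).2 ≤ (l.getD k (1, 0)).2 →
        ∀ (h1 : 1 ≤ ((l.take (k + 1)).map Prod.fst).sum)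
          (h2 : ((l.take (k + 1)).map Prod.fst).sum < n),
          i ⟨((l.take (k + 1)).map Prod.fst).sum - 1, by omega⟩ <
            i ⟨((l.take (k + 1)).map Prod.fst).sum, h2⟩) ∧
      (∑ t : Fin n, Finsupp.single ((colorWord l).getD (t : ℕ) 0, i t) 1) = d}).ncard : ℤ)
/-- The (skew) Schur function of the shape with cell set `D`, in the variables
`x^{(j)}_i` of color `j` (inside the ring of power series in all `r` sets of
variables): the generating function of semistandard fillings of `D`. -/
noncomputable def skewSchurIn {r : ℕ} (j : Fin r) (D : Finset (ℤ × ℤ)) :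
    MvPowerSeries (Fin r × ℕ) ℤ := fun d =>
  (({T : ℤ × ℤ → ℕ |
      (∀ c ∉ D, T c = 0) ∧
      (∀ c ∈ D, (c.1, c.2 + 1) ∈ D → T c ≤ T (c.1, c.2 + 1)) ∧
      (∀ c ∈ D, (c.1 + 1, c.2) ∈ D → T c < T (c.1 + 1, c.2)) ∧
      (∑ c ∈ D, Finsupp.single (j, T c) 1) = d}).ncard : ℤ)
/-- The colored ribbon Schur function of the colored composition `l` with
rainbow decomposition `(α_{(1)},ε_{(1)}) ⋯ (α_{(m)},ε_{(m)})`: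
`r_{(α,ε)} = r_{α_{(1)}}(x^{(ε_{(1)})}) ⋯ r_{α_{(m)}}(x^{(ε_{(m)})})`. -/
noncomputable def colRibbon {r : ℕ} (l : List (ℕ × Fin r)) :
    MvPowerSeries (Fin r × ℕ) ℤ :=
  ((rainbow l).map fun b => skewSchurIn b.2 (ribbonOfList b.1)).prod

section ColoredRuns

variable {r : ℕ} {β γ κ : Type*}

open Classical in
/-- The lengths and colors of the maximal runs of constant color `c` along which consecutive
letters are related by `R`. -/
noncomputable def colRuns (R : β → β → Prop) (c : β → κ) : List β → List (ℕ × κ)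
  | [] => []
  | [a] => [(1, c a)]
  | a :: b :: t =>
    if c a = c b ∧ R a b then (colRuns R c (b :: t)).modifyHead fun p => (p.1 + 1, p.2)
    else (1, c a) :: colRuns R c (b :: t)

lemma exists_colRuns_cons (R : β → β → Prop) (c : β → κ) (a : β) (t : List β) :
    ∃ m s, colRuns R c (a :: t) = (m + 1, c a) :: s := by
  induction t generalizing a with
  | nil => exact ⟨0, [], rfl⟩
  | cons b t ih =>
    obtain ⟨m, s, h⟩ := ih b
    by_cases hab : c a = c b ∧ R a b
    · exact ⟨m + 1, s, by simp [colRuns, hab, h]⟩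
    · exact ⟨0, (m + 1, c b) :: s, by simp [colRuns, hab, h]⟩

lemma colorWord_colRuns (R : β → β → Prop) (c : β → Fin r) (g : List β) :
    colorWord (colRuns R c g) = g.map c := by
  induction g with
  | nil => rfl
  | cons a t ih =>
    cases t with
    | nil => rfl
    | cons b t =>
      obtain ⟨m, s, h⟩ := exists_colRuns_cons R c b t
      by_cases hab : c a = c b ∧ R a b
      · rw [h] at ih
        simp only [colRuns, hab, h, List.map_cons, and_self, if_true, List.modifyHead_cons]
        simp only [List.map_cons] at ih
        rw [← ih]
        simp [colorWord, List.replicate_succ]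
      · simp only [colRuns, hab, if_false, List.map_cons] at ih ⊢
        rw [← ih]
        simp [colorWord]

lemma length_colorWord (l : List (ℕ × Fin r)) :
    (colorWord l).length = (l.map Prod.fst).sum := by
  induction l with
  | nil => rfl
  | cons p l ih =>
    have : colorWord (p :: l) = List.replicate p.1 p.2 ++ colorWord l := rfl
    simp [this, ih]

lemma sum_colRuns (R : β → β → Prop) (c : β → Fin r) (g : List β) :
    ((colRuns R c g).map Prod.fst).sum = g.length := by
  rw [← length_colorWord, colorWord_colRuns, List.length_map]

lemma colRuns_pos (R : β → β → Prop) (c : β → κ) (g : List β) :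
    ∀ p ∈ colRuns R c g, 0 < p.1 := by
  induction g with
  | nil => simp [colRuns]
  | cons a t ih =>
    cases t with
    | nil => simp [colRuns]
    | cons b t =>
      obtain ⟨m, s, h⟩ := exists_colRuns_cons R c b t
      by_cases hab : c a = c b ∧ R a b
      · simp only [h, List.mem_cons, forall_eq_or_imp] at ih
        simp only [colRuns, hab, h, and_self, if_true, List.modifyHead_cons, List.mem_cons,
          forall_eq_or_imp]
        exact ⟨by omega, ih.2⟩
      · simp only [colRuns, hab, if_false, List.mem_cons, forall_eq_or_imp] at ih ⊢
        exact ⟨by omega, ih⟩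

lemma cco_eq_colRuns (g : List (ℕ × Fin r)) :
    cco g = colRuns (fun a b => a.1 < b.1) Prod.snd g := by
  induction g with
  | nil => rfl
  | cons a t ih =>
    cases t with
    | nil => rfl
    | cons b t =>
      obtain ⟨m, s, h⟩ := exists_colRuns_cons (fun a b : ℕ × Fin r => a.1 < b.1) Prod.snd b t
      rw [h] at ih
      obtain ⟨a1, a2⟩ := a
      obtain ⟨b1, b2⟩ := b
      by_cases hab : a2 = b2 ∧ a1 < b1
      · rw [cco.eq_def]
        simp [ih, colRuns, hab, h]
      · rw [cco.eq_def]
        simp only [ih, colRuns, hab, h, if_false]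

lemma colRuns_map (R : γ → γ → Prop) (c : γ → κ) (f : β → γ) (g : List β) :
    colRuns R c (g.map f) = colRuns (fun a b => R (f a) (f b)) (fun a => c (f a)) g := by
  induction g with
  | nil => rfl
  | cons a t ih =>
    cases t with
    | nil => rfl
    | cons b t =>
      simp only [List.map_cons] at ih
      simp only [List.map_cons, colRuns, ih]

lemma colRuns_congr {R R' : β → β → Prop} {c : β → κ} {g : List β}
    (h : g.Pairwise fun a b => c a = c b → (R a b ↔ R' a b)) :
    colRuns R c g = colRuns R' c g := by
  induction g with
  | nil => rfl
  | cons a t ih =>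
    cases t with
    | nil => rfl
    | cons b t =>
      have hab := (List.pairwise_cons.1 h).1 b (by simp)
      simp only [colRuns, ih (List.pairwise_cons.1 h).2]
      classical exact if_congr (and_congr_right hab) rfl rfl

lemma colRuns_append {R : β → β → Prop} {c : β → κ} {g h : List β}
    (hgh : ∀ a ∈ g.getLast?, ∀ b ∈ h.head?, c a ≠ c b) :
    colRuns R c (g ++ h) = colRuns R c g ++ colRuns R c h := by
  induction g with
  | nil => rfl
  | cons a t ih =>
    cases t with
    | nil =>
      cases h with
      | nil => rfl
      | cons b h =>
        have : c a ≠ c b := hgh a (by simp) b (by simp)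
        simp [colRuns, this]
    | cons b t =>
      have ih := ih (by simpa using hgh)
      obtain ⟨m, s, h'⟩ := exists_colRuns_cons R c b t
      simp only [List.cons_append] at ih
      simp only [List.cons_append, colRuns, ih]
      split_ifs
      · simp [h']
      · rfl

lemma forall_partialSum_colRuns [Preorder κ] (R : β → β → Prop) (c : β → κ) (g : List β)
    (x : ℕ × κ) (Q : ℕ → Prop) :
    (∀ k, k + 1 < (colRuns R c g).length →
      ((colRuns R c g).getD (k + 1) x).2 ≤ ((colRuns R c g).getD k x).2 →
        Q ((((colRuns R c g).take (k + 1)).map Prod.fst).sum)) ↔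
    ∀ m (h : m + 1 < g.length), ¬ (c g[m] = c g[m + 1] ∧ R g[m] g[m + 1]) →
      c g[m + 1] ≤ c g[m] → Q (m + 1) := by
  induction g generalizing Q with
  | nil => simp [colRuns]
  | cons a t ih =>
    cases t with
    | nil => simp [colRuns]
    | cons b t =>
      obtain ⟨m, s, h⟩ := exists_colRuns_cons R c b t
      have ih := ih fun j => Q (j + 1)
      rw [h] at ih
      by_cases hab : c a = c b ∧ R a b
      · have hr : colRuns R c (a :: b :: t) = (m + 1 + 1, c b) :: s := by
          simp [colRuns, hab, h]
        rw [hr]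
        constructor
        · intro H j hj h1 h2
          cases j with
          | zero => exact absurd hab h1
          | succ j =>
            refine ih.1 (fun k hk hc => ?_) j (by simpa using hj) (by simpa using h1)
              (by simpa using h2)
            have := H k (by simpa using hk) (by cases k <;> simpa using hc)
            convert this using 1
            simp; omega
        · intro H k hk hc
          have := ih.2 (fun j hj h1 h2 => H (j + 1) (by simpa using hj) (by simpa using h1)
            (by simpa using h2)) k (by simpa using hk) (by cases k <;> simpa using hc)
          convert this using 1
          simp; omega
      · have hr : colRuns R c (a :: b :: t) = (1, c a) :: (m + 1, c b) :: s := by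
          simp [colRuns, hab, h]
        rw [hr]
        constructor
        · intro H j hj h1 h2
          cases j with
          | zero => exact H 0 (by simp) (by simpa using h2)
          | succ j =>
            refine ih.1 (fun k hk hc => ?_) j (by simpa using hj) (by simpa using h1)
              (by simpa using h2)
            have := H (k + 1) (by simpa using hk) (by simpa using hc)
            convert this using 1
            simp; omega
        · intro H k hk hc
          cases k with
          | zero => exact H 0 (by simp) hab (by simpa using hc)
          | succ k =>
            have := ih.2 (fun j hj h1 h2 => H (j + 1) (by simpa using hj) (by simpa using h1)
              (by simpa using h2)) k (by simpa using hk) (by simpa using hc)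
            convert this using 1
            simp; omega

end ColoredRuns

section WordEnumerator

variable {r : ℕ} {σ : Type*}

/-- The monomial exponent of a word in the variables `σ`. -/
noncomputable def wordWeight (g : List σ) : σ →₀ ℕ := (g.map fun a => Finsupp.single a 1).sum

lemma wordWeight_append (g h : List σ) :
    wordWeight (g ++ h) = wordWeight g + wordWeight h := by
  simp [wordWeight]

lemma wordWeight_eq_toFinsupp [DecidableEq σ] (g : List σ) :
    wordWeight g = Multiset.toFinsupp (g : Multiset σ) := by
  induction g with
  | nil => simp [wordWeight]
  | cons a t ih =>
    have : wordWeight (a :: t) = Finsupp.single a 1 + wordWeight t := by simp [wordWeight]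
    rw [this, ih, ← Multiset.cons_coe, ← Multiset.singleton_add, Multiset.toFinsupp_add,
      Multiset.toFinsupp_singleton]

lemma wordWeight_ofFn {n : ℕ} (f : Fin n → σ) :
    wordWeight (List.ofFn f) = ∑ t, Finsupp.single (f t) 1 := by
  rw [wordWeight, List.map_ofFn, List.sum_ofFn]
  rfl

lemma finite_setOf_wordWeight_eq (d : σ →₀ ℕ) : {g : List σ | wordWeight g = d}.Finite := by
  classical
  refine (Multiset.lists (Finsupp.toMultiset d)).finite_toSet.subset fun g hg => ?_
  simp only [Set.mem_ofPred_eq] at hg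
  change g ∈ Multiset.lists _
  rw [Multiset.mem_lists_iff, ← hg, wordWeight_eq_toFinsupp]
  simp

/-- The generating function of a set of words. -/
noncomputable def wordGenFun (S : Set (List σ)) : MvPowerSeries σ ℤ :=
  fun d => ({g | g ∈ S ∧ wordWeight g = d}.ncard : ℤ)

lemma finite_setOf_mem_and_wordWeight_eq (S : Set (List σ)) (d : σ →₀ ℕ) :
    {g | g ∈ S ∧ wordWeight g = d}.Finite :=
  (finite_setOf_wordWeight_eq d).subset fun _ h => h.2

lemma wordGenFun_singleton_nil : wordGenFun ({[]} : Set (List σ)) = 1 := by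
  classical
  ext d
  rw [MvPowerSeries.coeff_one]
  change (({g | g ∈ ({[]} : Set (List σ)) ∧ wordWeight g = d}.ncard : ℕ) : ℤ) = _
  split_ifs with h
  · have : {g | g ∈ ({[]} : Set (List σ)) ∧ wordWeight g = d} = {[]} := by
      ext g
      simp only [Set.mem_singleton_iff, Set.mem_ofPred_eq, and_iff_left_iff_imp]
      rintro rfl
      simp [wordWeight, h]
    rw [this]; simp
  · have : {g | g ∈ ({[]} : Set (List σ)) ∧ wordWeight g = d} = ∅ := by
      ext g
      simp only [Set.mem_singleton_iff, Set.mem_ofPred_eq, Set.mem_empty_iff_false, iff_false,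
        not_and]
      rintro rfl h'
      exact h (by simpa [wordWeight] using h'.symm)
    rw [this]; simp

lemma wordGenFun_mul (S T : Set (List σ)) (N : ℕ) (hS : ∀ g ∈ S, g.length = N) :
    wordGenFun S * wordGenFun T = wordGenFun (Set.image2 (· ++ ·) S T) := by
  classical
  ext d
  rw [MvPowerSeries.coeff_mul]
  change ∑ p ∈ Finset.HasAntidiagonal.antidiagonal d, (({g | g ∈ S ∧ wordWeight g = p.1}.ncard : ℕ) : ℤ) *
    (({g | g ∈ T ∧ wordWeight g = p.2}.ncard : ℕ) : ℤ) =
    (({g | g ∈ Set.image2 (· ++ ·) S T ∧ wordWeight g = d}.ncard : ℕ) : ℤ)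
  norm_cast
  rw [Set.ncard_eq_toFinset_card _ (finite_setOf_mem_and_wordWeight_eq _ d)]
  have : ∀ p ∈ Finset.HasAntidiagonal.antidiagonal d, {g | g ∈ S ∧ wordWeight g = p.1}.ncard *
      {g | g ∈ T ∧ wordWeight g = p.2}.ncard =
      ((finite_setOf_mem_and_wordWeight_eq S p.1).toFinset ×ˢ
        (finite_setOf_mem_and_wordWeight_eq T p.2).toFinset).card := fun p _ => by
    rw [Finset.card_product, Set.ncard_eq_toFinset_card _ (finite_setOf_mem_and_wordWeight_eq _ _),
      Set.ncard_eq_toFinset_card _ (finite_setOf_mem_and_wordWeight_eq _ _)]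
  rw [Finset.sum_congr rfl this, ← Finset.card_sigma]
  refine Finset.card_bij (fun x _ => x.2.1 ++ x.2.2) ?_ ?_ ?_
  · rintro ⟨p, g, h⟩ hx
    simp only [Finset.mem_sigma, Finset.HasAntidiagonal.mem_antidiagonal, Finset.mem_product,
      Set.Finite.mem_toFinset, Set.mem_ofPred_eq] at hx ⊢
    exact ⟨Set.mem_image2_of_mem hx.2.1.1 hx.2.2.1, by
      rw [wordWeight_append, hx.2.1.2, hx.2.2.2, hx.1]⟩
  · rintro ⟨p, g, h⟩ hx ⟨p', g', h'⟩ hx' heq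
    simp only [Finset.mem_sigma, Finset.HasAntidiagonal.mem_antidiagonal, Finset.mem_product,
      Set.Finite.mem_toFinset, Set.mem_ofPred_eq] at hx hx' heq
    obtain ⟨rfl, rfl⟩ := List.append_inj heq ((hS _ hx.2.1.1).trans (hS _ hx'.2.1.1).symm)
    obtain rfl : p = p' := Prod.ext (hx.2.1.2.symm.trans hx'.2.1.2)
      (hx.2.2.2.symm.trans hx'.2.2.2)
    rfl
  · intro g hg
    simp only [Set.Finite.mem_toFinset, Set.mem_ofPred_eq] at hg
    obtain ⟨⟨a, ha, b, hb, rfl⟩, hd⟩ := hg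
    refine ⟨⟨(wordWeight a, wordWeight b), a, b⟩, ?_, rfl⟩
    simp only [Finset.mem_sigma, Finset.HasAntidiagonal.mem_antidiagonal, Finset.mem_product,
      Set.Finite.mem_toFinset, Set.mem_ofPred_eq]
    exact ⟨by rw [← hd, wordWeight_append], ⟨ha, trivial⟩, hb, trivial⟩

/-- The colored words `(ε₁, i₁) ⋯ (ε_n, i_n)` whose maximal weakly increasing runs of constant
color have the lengths and colors recorded by `l`. -/
def runWords (l : List (ℕ × Fin r)) : Set (List (Fin r × ℕ)) :=
  {g | colRuns (fun a b => a.2 ≤ b.2) Prod.fst g = l}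

lemma length_eq_of_mem_runWords {l : List (ℕ × Fin r)} {g : List (Fin r × ℕ)}
    (hg : g ∈ runWords l) : g.length = (l.map Prod.fst).sum := by
  rw [← sum_colRuns (fun a b : Fin r × ℕ => a.2 ≤ b.2) Prod.fst g, hg]

lemma map_fst_eq_of_mem_runWords {l : List (ℕ × Fin r)} {g : List (Fin r × ℕ)}
    (hg : g ∈ runWords l) : g.map Prod.fst = colorWord l := by
  rw [← colorWord_colRuns (fun a b : Fin r × ℕ => a.2 ≤ b.2) Prod.fst g, hg]

lemma eq_of_append_eq_append_of_sum_eq {κ : Type*} {l₁ l₂ l₁' l₂' : List (ℕ × κ)}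
    (h : l₁ ++ l₂ = l₁' ++ l₂') (hp : ∀ p ∈ l₁ ++ l₂, 0 < p.1)
    (hs : (l₁.map Prod.fst).sum = (l₁'.map Prod.fst).sum) : l₁ = l₁' ∧ l₂ = l₂' := by
  have key : ∀ (u v : List (ℕ × κ)), (∀ p ∈ v, 0 < p.1) →
      (u.map Prod.fst).sum = ((u ++ v).map Prod.fst).sum → v = [] := by
    intro u v hv hs
    cases v with
    | nil => rfl
    | cons p v =>
      have := hv p (by simp)
      simp at hs
      omega
  rcases List.append_eq_append_iff.1 h with ⟨a, rfl, rfl⟩ | ⟨a, rfl, rfl⟩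
  · obtain rfl := key _ _ (fun p hpa => hp p (by simp [hpa])) hs
    simp
  · obtain rfl := key _ _ (fun p hpa => hp p (by simp [hpa])) hs.symm
    simp

lemma runWords_append {l₁ l₂ : List (ℕ × Fin r)} (hp : ∀ p ∈ l₁ ++ l₂, 0 < p.1)
    (hc : ∀ a ∈ (colorWord l₁).getLast?, ∀ b ∈ (colorWord l₂).head?, a ≠ b) :
    runWords (l₁ ++ l₂) = Set.image2 (· ++ ·) (runWords l₁) (runWords l₂) := by
  have key : ∀ g h : List (Fin r × ℕ), g.map Prod.fst = colorWord l₁ →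
      h.map Prod.fst = colorWord l₂ →
      colRuns (fun a b => a.2 ≤ b.2) Prod.fst (g ++ h) =
      colRuns (fun a b => a.2 ≤ b.2) Prod.fst g ++ colRuns (fun a b => a.2 ≤ b.2) Prod.fst h := by
    intro g h hg hh
    refine colRuns_append fun a ha b hb => hc _ ?_ _ ?_
    · rw [← hg, List.getLast?_map]
      exact Option.mem_map_of_mem _ ha
    · rw [← hh, List.head?_map]
      exact Option.mem_map_of_mem _ hb
  ext g
  constructor
  · intro hg
    have hm := map_fst_eq_of_mem_runWords hg
    have happ : colorWord (l₁ ++ l₂) = colorWord l₁ ++ colorWord l₂ := by simp [colorWord]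
    rw [happ] at hm
    obtain ⟨g₁, g₂, rfl, h₁, h₂⟩ := List.map_eq_append_iff.1 hm
    have hg' : colRuns (fun a b => a.2 ≤ b.2) Prod.fst (g₁ ++ g₂) = l₁ ++ l₂ := hg
    rw [key _ _ h₁ h₂] at hg'
    obtain ⟨e₁, e₂⟩ := eq_of_append_eq_append_of_sum_eq hg' (by rw [hg']; exact hp) (by
      rw [sum_colRuns, ← length_colorWord, ← h₁, List.length_map])
    exact ⟨g₁, e₁, g₂, e₂, rfl⟩
  · rintro ⟨g₁, h₁, g₂, h₂, rfl⟩
    change colRuns _ _ _ = _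
    rw [key _ _ (map_fst_eq_of_mem_runWords h₁) (map_fst_eq_of_mem_runWords h₂), h₁, h₂]

lemma wordGenFun_runWords_append {l₁ l₂ : List (ℕ × Fin r)} (hp : ∀ p ∈ l₁ ++ l₂, 0 < p.1)
    (hc : ∀ a ∈ (colorWord l₁).getLast?, ∀ b ∈ (colorWord l₂).head?, a ≠ b) :
    wordGenFun (runWords (l₁ ++ l₂)) =
      wordGenFun (runWords l₁) * wordGenFun (runWords l₂) := by
  rw [runWords_append hp hc, wordGenFun_mul _ _ _ fun g hg => length_eq_of_mem_runWords hg]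

end WordEnumerator

section Ribbon

variable {r : ℕ}

/-- The cells of a ribbon in reading order, from the bottom left to the top right. -/
def ribbonCells : List ℕ → ℤ × ℤ → List (ℤ × ℤ)
  | [], _ => []
  | a :: b, p =>
    (List.range a).map (fun j : ℕ => (p.1, p.2 + (j : ℤ))) ++
      ribbonCells b (p.1 - 1, p.2 + (a : ℤ) - 1)

lemma toFinset_ribbonCells (b : List ℕ) (p : ℤ × ℤ) :
    (ribbonCells b p).toFinset = ribbonAux b p := by
  induction b generalizing p with
  | nil => rfl
  | cons a b ih =>
    rw [ribbonCells, ribbonAux, List.toFinset_append, ih]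
    congr 1

lemma length_ribbonCells (b : List ℕ) (p : ℤ × ℤ) : (ribbonCells b p).length = b.sum := by
  induction b generalizing p with
  | nil => rfl
  | cons a b ih => simp [ribbonCells, ih]

lemma ribbonCells_one_cons (b : List ℕ) (p : ℤ × ℤ) :
    ribbonCells (1 :: b) p = p :: ribbonCells b (p.1 - 1, p.2) := by
  simp [ribbonCells]

lemma ribbonCells_succ_cons (a : ℕ) (b : List ℕ) (p : ℤ × ℤ) :
    ribbonCells ((a + 1) :: b) p = p :: ribbonCells (a :: b) (p.1, p.2 + 1) := by
  simp only [ribbonCells, List.range_succ_eq_map, List.map_cons, List.map_map, List.cons_append]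
  congr 1
  · simp
  · congr 1
    · refine List.map_congr_left fun j _ => ?_
      simp only [Function.comp_apply, Prod.mk.injEq, true_and]
      push_cast
      ring
    · congr 2
      push_cast
      ring

/-- Induction on nonempty ribbons by removing the first cell. -/
lemma ribbon_induction {P : ∀ b : List ℕ, b ≠ [] → (∀ x ∈ b, 0 < x) → ℤ × ℤ → Prop}
    (single : ∀ p, P [1] (by simp) (by simp) p)
    (up : ∀ a b p (h : ∀ x ∈ a :: b, 0 < x), P (a :: b) (by simp) h (p.1 - 1, p.2) →
      P (1 :: a :: b) (by simp) (List.forall_mem_cons.2 ⟨one_pos, h⟩) p)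
    (right : ∀ a b p (h : ∀ x ∈ (a + 1) :: b, 0 < x), P ((a + 1) :: b) (by simp) h (p.1, p.2 + 1) →
      P ((a + 2) :: b) (by simp)
        (List.forall_mem_cons.2 ⟨Nat.succ_pos _, (List.forall_mem_cons.1 h).2⟩) p)
    (b : List ℕ) (hb : b ≠ []) (hpos : ∀ x ∈ b, 0 < x) (p : ℤ × ℤ) : P b hb hpos p := by
  induction b generalizing p with
  | nil => exact absurd rfl hb
  | cons a b ih =>
    obtain ⟨a, rfl⟩ : ∃ a', a = a' + 1 := ⟨a - 1, by have := hpos a (by simp); omega⟩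
    induction a generalizing p with
    | zero =>
      cases b with
      | nil => exact single p
      | cons a b =>
        have h : ∀ x ∈ a :: b, 0 < x := fun x hx => hpos x (by simp [hx])
        exact up a b p h (ih (by simp) h _)
    | succ a iha =>
      exact right a b p (List.forall_mem_cons.2 ⟨Nat.succ_pos _, (List.forall_mem_cons.1 hpos).2⟩)
        (iha _ (by simp) _)

lemma exists_ribbonCells_eq_cons {b : List ℕ} (hb : b ≠ []) (hpos : ∀ x ∈ b, 0 < x)
    (p : ℤ × ℤ) : ∃ L, ribbonCells b p = p :: L := by
  obtain ⟨a, b, rfl⟩ := List.exists_cons_of_ne_nil hb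
  obtain ⟨a, rfl⟩ : ∃ a', a = a' + 1 := ⟨a - 1, by have := hpos a (by simp); omega⟩
  exact ⟨_, ribbonCells_succ_cons a b p⟩

lemma content_lt_of_mem_ribbonCells {b : List ℕ} (hb : b ≠ []) (hpos : ∀ x ∈ b, 0 < x)
    (p : ℤ × ℤ) : ∀ c ∈ ribbonCells b p, c = p ∨ p.2 - p.1 < c.2 - c.1 := by
  induction b, hb, hpos, p using ribbon_induction with
  | single p => simp [ribbonCells]
  | up a b p h ih =>
    intro c hc
    rw [ribbonCells_one_cons, List.mem_cons] at hc
    rcases hc with rfl | hc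
    · exact Or.inl rfl
    · rcases ih c hc with rfl | h
      · right; simp
      · right; simp at h; omega
  | right a b p h ih =>
    intro c hc
    rw [ribbonCells_succ_cons, List.mem_cons] at hc
    rcases hc with rfl | hc
    · exact Or.inl rfl
    · rcases ih c hc with rfl | h
      · right; simp
      · right; simp at h; omega

lemma nodup_ribbonCells {b : List ℕ} (hpos : ∀ x ∈ b, 0 < x)
    (p : ℤ × ℤ) : (ribbonCells b p).Nodup := by
  rcases eq_or_ne b [] with rfl | hb
  · simp [ribbonCells]
  induction b, hb, hpos, p using ribbon_induction with
  | single p => simp [ribbonCells]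
  | up a b p h ih =>
    rw [ribbonCells_one_cons, List.nodup_cons]
    refine ⟨fun hp => ?_, ih⟩
    rcases content_lt_of_mem_ribbonCells (by simp) h _ p hp with h | h
    · have := congrArg Prod.fst h
      simp at this
      omega
    · simp at h
      omega
  | right a b p h ih =>
    rw [ribbonCells_succ_cons, List.nodup_cons]
    refine ⟨fun hp => ?_, ih⟩
    rcases content_lt_of_mem_ribbonCells (by simp) h _ p hp with h | h
    · simpa using congrArg Prod.snd h
    · simp at h

/-- A filling of the cells in the list `L` is semistandard. -/
def IsSemistandardOn (T : ℤ × ℤ → ℕ) (L : List (ℤ × ℤ)) : Prop :=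
  (∀ c ∈ L, (c.1, c.2 + 1) ∈ L → T c ≤ T (c.1, c.2 + 1)) ∧
    ∀ c ∈ L, (c.1 + 1, c.2) ∈ L → T c < T (c.1 + 1, c.2)

lemma isSemistandardOn_cons_right {T : ℤ × ℤ → ℕ} {p : ℤ × ℤ} {L : List (ℤ × ℤ)}
    (hmem : (p.1, p.2 + 1) ∈ L)
    (hL : ∀ c ∈ L, c = (p.1, p.2 + 1) ∨ p.2 + 1 - p.1 < c.2 - c.1) :
    IsSemistandardOn T (p :: L) ↔ T p ≤ T (p.1, p.2 + 1) ∧ IsSemistandardOn T L := by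
  obtain ⟨p1, p2⟩ := p
  constructor
  · rintro ⟨h1, h2⟩
    exact ⟨h1 _ (by simp) (by simp [hmem]),
      fun c hc hc' => h1 c (by simp [hc]) (by simp [hc']),
      fun c hc hc' => h2 c (by simp [hc]) (by simp [hc'])⟩
  · rintro ⟨h0, h1, h2⟩
    refine ⟨fun c hc hc' => ?_, fun c hc hc' => ?_⟩
    · rcases List.mem_cons.1 hc with rfl | hc
      · exact h0
      · rcases List.mem_cons.1 hc' with hc' | hc'
        · have := hL c hc
          simp only [Prod.ext_iff] at this hc'
          omega
        · exact h1 c hc hc'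
    · rcases List.mem_cons.1 hc with rfl | hc
      · rcases List.mem_cons.1 hc' with hc' | hc'
        · simp at hc'
        · have := hL _ hc'
          simp only [Prod.ext_iff] at this
          omega
      · rcases List.mem_cons.1 hc' with hc' | hc'
        · have := hL c hc
          simp only [Prod.ext_iff] at this hc'
          omega
        · exact h2 c hc hc'

lemma isSemistandardOn_cons_up {T : ℤ × ℤ → ℕ} {p : ℤ × ℤ} {L : List (ℤ × ℤ)}
    (hmem : (p.1 - 1, p.2) ∈ L)
    (hL : ∀ c ∈ L, c = (p.1 - 1, p.2) ∨ p.2 - (p.1 - 1) < c.2 - c.1) :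
    IsSemistandardOn T (p :: L) ↔ T (p.1 - 1, p.2) < T p ∧ IsSemistandardOn T L := by
  obtain ⟨p1, p2⟩ := p
  constructor
  · rintro ⟨h1, h2⟩
    refine ⟨?_, fun c hc hc' => h1 c (by simp [hc]) (by simp [hc']),
      fun c hc hc' => h2 c (by simp [hc]) (by simp [hc'])⟩
    simpa using h2 (p1 - 1, p2) (List.mem_cons_of_mem _ hmem) (by simp)
  · rintro ⟨h0, h1, h2⟩
    refine ⟨fun c hc hc' => ?_, fun c hc hc' => ?_⟩
    · rcases List.mem_cons.1 hc with rfl | hc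
      · rcases List.mem_cons.1 hc' with hc' | hc'
        · simp at hc'
        · have := hL _ hc'
          simp only [Prod.ext_iff] at this
          omega
      · rcases List.mem_cons.1 hc' with hc' | hc'
        · have := hL c hc
          simp only [Prod.ext_iff] at this hc'
          omega
        · exact h1 c hc hc'
    · rcases List.mem_cons.1 hc with rfl | hc
      · rcases List.mem_cons.1 hc' with hc' | hc'
        · simp at hc'
        · have := hL _ hc'
          simp only [Prod.ext_iff] at this
          omega
      · rcases List.mem_cons.1 hc' with hc' | hc'
        · rcases hL c hc with rfl | h
          · simpa using h0
          · simp only [Prod.ext_iff] at hc' h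
            omega
        · exact h2 c hc hc'

lemma isSemistandardOn_ribbonCells_iff (T : ℤ × ℤ → ℕ) (j : Fin r) {b : List ℕ} (hb : b ≠ [])
    (hpos : ∀ x ∈ b, 0 < x) (p : ℤ × ℤ) :
    IsSemistandardOn T (ribbonCells b p) ↔
      colRuns (fun c c' => T c ≤ T c') (fun _ => j) (ribbonCells b p) = b.map (·, j) := by
  induction b, hb, hpos, p using ribbon_induction with
  | single p => simp [ribbonCells, IsSemistandardOn, colRuns, Prod.ext_iff]
  | up a b p h ih =>
    obtain ⟨L, hL⟩ := exists_ribbonCells_eq_cons (b := a :: b) (by simp) h (p.1 - 1, p.2)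
    rw [ribbonCells_one_cons, isSemistandardOn_cons_up (by simp [hL])
      (content_lt_of_mem_ribbonCells (by simp) h _), ih, hL, colRuns]
    obtain ⟨m, s, hs⟩ := exists_colRuns_cons (fun c c' => T c ≤ T c') (fun _ => j)
      (p.1 - 1, p.2) L
    by_cases hT : T p ≤ T (p.1 - 1, p.2)
    · simp [hT, hs]
    · simp [hT, not_le.1 hT]
  | right a b p h ih =>
    obtain ⟨L, hL⟩ := exists_ribbonCells_eq_cons (b := (a + 1) :: b) (by simp) h (p.1, p.2 + 1)
    rw [ribbonCells_succ_cons, isSemistandardOn_cons_right (by simp [hL])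
      (content_lt_of_mem_ribbonCells (by simp) h _), ih, hL, colRuns]
    obtain ⟨m, s, hs⟩ := exists_colRuns_cons (fun c c' => T c ≤ T c') (fun _ => j)
      (p.1, p.2 + 1) L
    by_cases hT : T p ≤ T (p.1, p.2 + 1)
    · simp [hT, hs]
    · simp [hT]

/-- The skew Schur function of a ribbon enumerates the words of a single color. -/
lemma skewSchurIn_ribbonOfList (j : Fin r) {b : List ℕ} (hb : b ≠ [])
    (hpos : ∀ x ∈ b, 0 < x) :
    skewSchurIn j (ribbonOfList b) = wordGenFun (runWords (b.map (·, j))) := by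
  funext d
  have hnd := nodup_ribbonCells hpos (0, 0)
  have hset : ribbonOfList b = (ribbonCells b (0, 0)).toFinset :=
    (toFinset_ribbonCells b (0, 0)).symm
  have hss := fun T => isSemistandardOn_ribbonCells_iff T j hb hpos (0, 0)
  have hlen := length_ribbonCells b (0, 0)
  rw [skewSchurIn, wordGenFun, hset, Nat.cast_inj]
  generalize ribbonCells b (0, 0) = L at hnd hss hlen
  have hword : ∀ T : ℤ × ℤ → ℕ, IsSemistandardOn T L ↔
      L.map (fun c => (j, T c)) ∈ runWords (b.map (·, j)) := fun T => by
    rw [hss, runWords, Set.mem_ofPred_eq, colRuns_map]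
  have hweight : ∀ T : ℤ × ℤ → ℕ, ∑ c ∈ L.toFinset, Finsupp.single (j, T c) 1 =
      wordWeight (L.map fun c => (j, T c)) := fun T => by
    rw [List.sum_toFinset _ hnd, wordWeight, List.map_map]
    rfl
  refine Set.ncard_congr (fun T _ => L.map fun c => (j, T c)) ?_ ?_ ?_
  · rintro T ⟨-, h1, h2, hd⟩
    refine ⟨(hword T).1 ⟨fun c hc hc' => h1 c (by simpa using hc) (by simpa using hc'),
      fun c hc hc' => h2 c (by simpa using hc) (by simpa using hc')⟩, ?_⟩
    rw [← hweight, hd]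
  · rintro T T' ⟨h0, -⟩ ⟨h0', -⟩ heq
    funext c
    by_cases hc : c ∈ L
    · simpa using List.map_inj_left.1 heq c hc
    · rw [h0 c (by simpa using hc), h0' c (by simpa using hc)]
  · rintro g ⟨hg, hd⟩
    have hgl : g.length = L.length := by
      rw [length_eq_of_mem_runWords hg, hlen, List.map_map]
      simp [Function.comp_def]
    have hgc : ∀ x ∈ g, x.1 = j := fun x hx => by
      have : x.1 ∈ g.map Prod.fst := List.mem_map_of_mem hx
      rw [map_fst_eq_of_mem_runWords hg] at this
      simp [colorWord] at this
      grind
    let T : ℤ × ℤ → ℕ := fun c => ((g[L.idxOf c]?).map Prod.snd).getD 0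
    have hT : L.map (fun c => (j, T c)) = g := by
      refine List.ext_getElem (by simp [hgl]) fun i h1 h2 => ?_
      have hi : i < L.length := by simpa using h1
      refine Prod.ext ?_ ?_
      · simp [hgc _ (List.getElem_mem h2)]
      · simp [T, hnd.idxOf_getElem i hi, h2]
    have hTs := (hword T).2 (by rw [hT]; exact hg)
    refine ⟨T, ⟨fun c hc => ?_, fun c hc hc' => hTs.1 c (by simpa using hc) (by simpa using hc'),
      fun c hc hc' => hTs.2 c (by simpa using hc) (by simpa using hc'), ?_⟩, hT⟩
    · have : c ∉ L := by simpa using hc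
      simp [T, List.idxOf_eq_length_iff.2 this, hgl]
    · rw [hweight, hT, hd]

lemma rainbow_cons_of_ne {a : ℕ} {c : Fin r} {l : List (ℕ × Fin r)}
    (h : ∀ b ∈ (rainbow l).head?, c ≠ b.2) : rainbow ((a, c) :: l) = ([a], c) :: rainbow l := by
  rw [rainbow.eq_def]
  rcases hl : rainbow l with _ | ⟨⟨b, c'⟩, bs⟩
  · simp [hl]
  · rw [hl] at h
    have : c ≠ c' := by simpa using h
    simp [hl, this]

lemma rainbow_cons_of_eq {a : ℕ} {c : Fin r} {l : List (ℕ × Fin r)} {b : List ℕ}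
    {bs : List (List ℕ × Fin r)} (h : rainbow l = (b, c) :: bs) :
    rainbow ((a, c) :: l) = (a :: b, c) :: bs := by
  rw [rainbow.eq_def]
  simp [h]

lemma rainbow_spec (l : List (ℕ × Fin r)) :
    ((rainbow l).map fun b => b.1.map (·, b.2)).flatten = l ∧
    (∀ b ∈ rainbow l, b.1 ≠ []) ∧
    (rainbow l).IsChain (fun b b' => b.2 ≠ b'.2) := by
  induction l with
  | nil => simp [rainbow]
  | cons p l ih =>
    obtain ⟨a, c⟩ := p
    obtain ⟨h1, h2, h3⟩ := ih
    by_cases h : ∀ b ∈ (rainbow l).head?, c ≠ b.2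
    · rw [rainbow_cons_of_ne h]
      exact ⟨by simp [h1], by simpa using h2, List.isChain_cons.2 ⟨h, h3⟩⟩
    · push Not at h
      obtain ⟨⟨b, c'⟩, hb, rfl⟩ := h
      obtain ⟨bs, hbs⟩ := List.head?_eq_some_iff.1 hb
      rw [hbs] at h1 h2 h3
      rw [rainbow_cons_of_eq hbs]
      refine ⟨by simp [← h1], by simpa using fun b c h => h2 (b, c) (by simp [h]), ?_⟩
      rw [List.isChain_cons] at h3 ⊢
      exact h3

lemma prod_skewSchurIn_eq_wordGenFun (bs : List (List ℕ × Fin r)) (hne : ∀ b ∈ bs, b.1 ≠ [])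
    (hpos : ∀ b ∈ bs, ∀ x ∈ b.1, 0 < x) (hch : bs.IsChain (fun b b' => b.2 ≠ b'.2)) :
    (bs.map fun b => skewSchurIn b.2 (ribbonOfList b.1)).prod =
      wordGenFun (runWords (bs.map fun b => b.1.map (·, b.2)).flatten) := by
  induction bs with
  | nil =>
    have : runWords ([] : List (ℕ × Fin r)) = {[]} := by
      ext g
      constructor
      · intro hg
        simpa using length_eq_of_mem_runWords hg
      · rintro rfl
        rfl
    simp [this, wordGenFun_singleton_nil]
  | cons b bs ih =>
    obtain ⟨hc, hch⟩ := List.isChain_cons.1 hch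
    have hpos' := hpos
    rw [List.forall_mem_cons] at hne hpos
    have hmem : ∀ (b : List ℕ × Fin r), ∀ x ∈ colorWord (b.1.map (·, b.2)), x = b.2 := by
      intro b x hx
      simp [colorWord] at hx
      grind
    rw [List.map_cons, List.prod_cons, ih hne.2 hpos.2 hch,
      skewSchurIn_ribbonOfList _ hne.1 hpos.1, List.map_cons, List.flatten_cons,
      wordGenFun_runWords_append]
    · intro p hp
      rw [← List.flatten_cons, ← List.map_cons (f := fun b : List ℕ × Fin r => b.1.map (·, b.2)),
        List.mem_flatten] at hp
      obtain ⟨_, hmap, hp⟩ := hp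
      obtain ⟨q, hq, rfl⟩ := List.mem_map.1 hmap
      obtain ⟨x, hx, rfl⟩ := List.mem_map.1 hp
      exact hpos' q hq x hx
    · intro x hx y hy
      rw [hmem b x (List.mem_of_getLast? hx)]
      cases bs with
      | nil => simp [colorWord] at hy
      | cons b' bs =>
        have hb' : colorWord (b'.1.map (·, b'.2)) ≠ [] := by
          obtain ⟨m, t, ht⟩ := List.exists_cons_of_ne_nil (hne.2 b' (by simp))
          have := hpos.2 b' (by simp) m (by simp [ht])
          intro h
          have := congrArg List.length h
          rw [length_colorWord, ht] at this
          simp at this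
          omega
        have happ : colorWord (((b' :: bs).map fun b => b.1.map (·, b.2)).flatten) =
            colorWord (b'.1.map (·, b'.2)) ++
              colorWord ((bs.map fun b => b.1.map (·, b.2)).flatten) := by
          simp [colorWord]
        rw [happ, List.head?_append_of_ne_nil _ hb'] at hy
        rw [hmem b' y (List.mem_of_head? hy)]
        exact hc b' (by simp)

lemma colRibbon_eq_wordGenFun (l : List (ℕ × Fin r)) (hpos : ∀ p ∈ l, 0 < p.1) :
    colRibbon l = wordGenFun (runWords l) := by
  obtain ⟨h1, h2, h3⟩ := rainbow_spec l
  rw [colRibbon, prod_skewSchurIn_eq_wordGenFun _ h2 _ h3, h1]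
  intro b hb x hx
  refine hpos (x, b.2) ?_
  rw [← h1, List.mem_flatten]
  exact ⟨_, List.mem_map_of_mem hb, List.mem_map_of_mem hx⟩

end Ribbon

section Standardization

variable {n r : ℕ}

/-- Letters of a colored word ordered by value, then color, then position. -/
def sortKey (f : Fin n → Fin r × ℕ) (k : Fin n) : ℕ ×ₗ (Fin r ×ₗ Fin n) :=
  toLex ((f k).2, toLex ((f k).1, k))

lemma sortKey_injective (f : Fin n → Fin r × ℕ) : Function.Injective (sortKey f) := by
  intro a b h
  exact congrArg (fun x => (ofLex (ofLex x).2).2) h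

lemma strictMono_sortKey_comp_iff {f : Fin n → Fin r × ℕ} {σ : Equiv.Perm (Fin n)} :
    StrictMono (sortKey f ∘ σ) ↔ σ = Tuple.sort (sortKey f) := by
  have hsort : StrictMono (sortKey f ∘ Tuple.sort (sortKey f)) :=
    (Tuple.monotone_sort (sortKey f)).strictMono_of_injective
      ((sortKey_injective f).comp (Equiv.injective _))
  constructor
  · intro h
    have := (h.range_inj hsort).1 (by simp [Set.range_comp])
    exact Equiv.ext fun k => sortKey_injective f (congrFun this k)
  · rintro rfl
    exact hsort

lemma cco_cword_inv {f : Fin n → Fin r × ℕ} {σ : Equiv.Perm (Fin n)} {z : Fin n → Fin r}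
    (hσ : StrictMono (sortKey f ∘ σ)) (hz : ∀ t, z t = (f (σ t)).1) :
    cco (cword σ⁻¹ fun k => z (σ⁻¹ k)) =
      colRuns (fun a b => a.2 ≤ b.2) Prod.fst (List.ofFn f) := by
  rw [cco_eq_colRuns, cword, colRuns_map, List.ofFn_eq_map, colRuns_map]
  have hc : (fun k => z (σ⁻¹ k)) = fun k => (f k).1 := by
    funext k
    simp [hz]
  simp only [hc]
  refine colRuns_congr ((List.pairwise_lt_finRange n).imp fun {a b} hab hcol => ?_)
  have h := hσ.lt_iff_lt (a := σ⁻¹ a) (b := σ⁻¹ b)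
  have hinv : ∀ k, σ (σ⁻¹ k) = k := fun k => by simp
  simp only [Function.comp_apply, hinv, sortKey, Prod.Lex.toLex_lt_toLex] at h
  rw [Fin.val_fin_lt, ← h]
  simp only [hcol, lt_irrefl, false_or, hab, and_true]
  exact le_iff_lt_or_eq.symm

lemma Fcol_cco_cword [NeZero r] (hn : 0 < n) (π : Equiv.Perm (Fin n)) (z : Fin n → Fin r)
    (d : Fin r × ℕ →₀ ℕ) :
    Fcol n (cco (cword π z)) d =
      ({i : Fin n → ℕ | StrictMono (fun t => toLex (i t, toLex (z t, π t))) ∧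
        ∑ t, Finsupp.single (z t, i t) 1 = d}.ncard : ℤ) := by
  rw [Fcol, Nat.cast_inj]
  congr 1
  ext i
  rw [Set.mem_ofPred_eq, Set.mem_ofPred_eq, ← and_assoc]
  have hcol : ∀ t : Fin n, (colorWord (cco (cword π z))).getD (t : ℕ) 0 = z t := fun t => by
    rw [cco_eq_colRuns, colorWord_colRuns, cword, List.map_map]
    simp [List.getD_eq_getElem?_getD]
  simp only [hcol]
  refine and_congr_left fun _ => ?_
  have key := forall_partialSum_colRuns (fun a b : ℕ × Fin r => a.1 < b.1) Prod.snd (cword π z)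
    (1, 0) fun m => ∀ (h1 : 1 ≤ m) (h2 : m < n), i ⟨m - 1, by omega⟩ < i ⟨m, h2⟩
  rw [← cco_eq_colRuns] at key
  rw [key]
  obtain ⟨N, rfl⟩ : ∃ N, n = N + 1 := ⟨n - 1, by omega⟩
  rw [Fin.monotone_iff_le_succ, Fin.strictMono_iff_lt_succ]
  have hstep : (∀ m (h : m + 1 < (cword π z).length),
      ¬ ((cword π z)[m].2 = (cword π z)[m + 1].2 ∧ (cword π z)[m].1 < (cword π z)[m + 1].1) →
      (cword π z)[m + 1].2 ≤ (cword π z)[m].2 →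
      ∀ (h1 : 1 ≤ m + 1) (h2 : m + 1 < N + 1), i ⟨m + 1 - 1, by omega⟩ < i ⟨m + 1, h2⟩) ↔
      ∀ t : Fin N, ¬ (z t.castSucc = z t.succ ∧ π t.castSucc < π t.succ) →
        z t.succ ≤ z t.castSucc → i t.castSucc < i t.succ := by
    constructor
    · intro H t h1 h2
      refine H t (by simp [cword]) ?_ ?_ (by omega) (by omega)
      · simp only [cword, List.getElem_map, List.getElem_finRange]
        exact h1
      · simp only [cword, List.getElem_map, List.getElem_finRange]
        exact h2
    · intro H m h h1 h2 _ hm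
      refine H ⟨m, by omega⟩ ?_ ?_
      · simpa [cword] using h1
      · simpa [cword] using h2
  rw [hstep, ← forall_and]
  refine forall_congr' fun t => ?_
  simp only [Prod.Lex.toLex_lt_toLex]
  have hcs : π t.castSucc ≠ π t.succ := by simp [Fin.ext_iff]
  grind

lemma ncard_runWords (l : List (ℕ × Fin r)) (hsum : (l.map Prod.fst).sum = n)
    (d : Fin r × ℕ →₀ ℕ) :
    {g | g ∈ runWords l ∧ wordWeight g = d}.ncard =
      {f : Fin n → Fin r × ℕ | List.ofFn f ∈ runWords l ∧ wordWeight (List.ofFn f) = d}.ncard := by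
  rw [← Set.ncard_image_of_injective _ List.ofFn_injective]
  congr 1
  ext g
  constructor
  · rintro ⟨hg, hd⟩
    have hlen : g.length = n := (length_eq_of_mem_runWords hg).trans hsum
    subst hlen
    exact ⟨g.get, by simpa using ⟨hg, hd⟩, by simp⟩
  · rintro ⟨f, hf, rfl⟩
    exact hf

lemma wordGenFun_runWords_eq_sum_Fcol [NeZero r] (hn : 0 < n) (l : List (ℕ × Fin r))
    (hsum : (l.map Prod.fst).sum = n) :
    wordGenFun (runWords l) =
      ∑ w ∈ Finset.univ.filter
          (fun w : Equiv.Perm (Fin n) × (Fin n → Fin r) =>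
            cco (cword w.1⁻¹ fun i => w.2 (w.1⁻¹ i)) = l),
        Fcol n (cco (cword w.1 w.2)) := by
  ext d
  have hcoeff : ∀ φ : MvPowerSeries (Fin r × ℕ) ℤ, MvPowerSeries.coeff d φ = φ d := fun _ => rfl
  rw [map_sum]
  simp only [hcoeff, Fcol_cco_cword hn]
  rw [wordGenFun]
  norm_cast
  rw [ncard_runWords l hsum d]
  have hfin : {f : Fin n → Fin r × ℕ |
      List.ofFn f ∈ runWords l ∧ wordWeight (List.ofFn f) = d}.Finite :=
    (finite_setOf_mem_and_wordWeight_eq (runWords l) d).preimage List.ofFn_injective.injOn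
  rw [Set.ncard_eq_toFinset_card _ hfin,
    Finset.card_eq_sum_card_fiberwise (t := Finset.univ.filter
      (fun w : Equiv.Perm (Fin n) × (Fin n → Fin r) =>
        cco (cword w.1⁻¹ fun i => w.2 (w.1⁻¹ i)) = l))
      (f := fun f => (Tuple.sort (sortKey f), fun t => (f (Tuple.sort (sortKey f) t)).1))]
  · refine Finset.sum_congr rfl fun w hw => ?_
    obtain ⟨π, z⟩ := w
    have hw : cco (cword π⁻¹ fun i => z (π⁻¹ i)) = l := (Finset.mem_filter.1 hw).2
    rw [← Set.ncard_coe_finset]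
    have hweight : ∀ f : Fin n → Fin r × ℕ, wordWeight (List.ofFn f) =
        ∑ t, Finsupp.single (f (π t)) 1 := fun f => by
      rw [wordWeight_ofFn]
      exact (Equiv.sum_comp π fun t => Finsupp.single (f t) 1).symm
    refine Set.ncard_congr (fun f _ t => (f (π t)).2) ?_ ?_ ?_
    · intro f hf
      simp only [Finset.coe_filter, Set.Finite.mem_toFinset, Set.mem_ofPred_eq,
        Prod.mk.injEq] at hf
      obtain ⟨⟨-, hd⟩, rfl, rfl⟩ := hf
      exact ⟨strictMono_sortKey_comp_iff.2 rfl, by rw [← hd, hweight]⟩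
    · intro f f' hf hf' heq
      simp only [Finset.coe_filter, Set.Finite.mem_toFinset, Set.mem_ofPred_eq,
        Prod.mk.injEq] at hf hf'
      obtain ⟨-, h1, h2⟩ := hf
      obtain ⟨-, h1', h2'⟩ := hf'
      rw [h1] at h2
      rw [h1'] at h2'
      funext k
      obtain ⟨t, rfl⟩ := π.surjective k
      exact Prod.ext ((congrFun h2 t).trans (congrFun h2' t).symm) (congrFun heq t)
    · rintro i ⟨hi, hd⟩
      let f : Fin n → Fin r × ℕ := fun k => (z (π⁻¹ k), i (π⁻¹ k))
      have hfπ : ∀ t, f (π t) = (z t, i t) := fun t => by simp [f]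
      have hmono : StrictMono (sortKey f ∘ π) := by
        convert hi using 2 with t
        simp [sortKey, hfπ]
      refine ⟨f, ?_, by simp [hfπ]⟩
      simp only [Finset.coe_filter, Set.Finite.mem_toFinset, Set.mem_ofPred_eq, Prod.mk.injEq]
      have hsort := strictMono_sortKey_comp_iff.1 hmono
      refine ⟨⟨?_, by simp [hweight, hfπ, hd]⟩, hsort.symm, ?_⟩
      · rw [← hw]
        exact (cco_cword_inv hmono fun t => by rw [hfπ]).symm
      · rw [← hsort]
        funext t
        rw [hfπ]
  · intro f hf
    obtain ⟨hf, -⟩ := hfin.mem_toFinset.1 hf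
    simp only [Finset.coe_filter, Finset.mem_univ, true_and, Set.mem_ofPred_eq]
    rw [← hf]
    exact cco_cword_inv (strictMono_sortKey_comp_iff.2 rfl) fun _ => rfl

end Standardization

/-- For every `r`-colored composition `(α,ε)` of `n` (given
as the list `l` of colored parts), the colored ribbon Schur function equals the
colored quasisymmetric generating function of the conjugate-inverse colored
descent class:
`r_{(α,ε)} = Σ_{(π,z) ∈ D̄_{(α,ε)}⁻¹} F^{(r)}_{co(π,z)}`. -/
theorem statement12 (n r : ℕ) (hn : 0 < n) [NeZero r] (l : List (ℕ × Fin r))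
    (hpos : ∀ p ∈ l, 0 < p.1) (hsum : (l.map Prod.fst).sum = n) :
    colRibbon l =
      ∑ w ∈ Finset.univ.filter
          (fun w : Equiv.Perm (Fin n) × (Fin n → Fin r) =>
            cco (cword w.1⁻¹ fun i => w.2 (w.1⁻¹ i)) = l),
        Fcol n (cco (cword w.1 w.2)) := by
  rw [colRibbon_eq_wordGenFun l hpos, wordGenFun_runWords_eq_sum_Fcol hn l hsum]
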